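/- Let 0 < b ≤ T, r, K ≥ 0, and suppose ‖F(t,x)‖ ≤ K for all t ∈ [0,T] and all x with ‖x‖ ≤ r. Let X₀ ∈ 𝒳 and let X : [0,b) → 𝒳 be continuous with sup_{t∈[0,b)} ‖X(t)‖ ≤ r and X(t) = U(t,0)X₀ + ∫₀ᵗ U(t,s)F(s,X(s)) ds for every t ∈ [0,b). Then the limit ℓ = lim_{t→b⁻} X(t) exists in 𝒳, and the extension X̄ : [0,b] → 𝒳 with X̄(t) = X(t) for t < b and X̄(b) = ℓ is a mild solution on [0,b] with initial datum X₀. In particular, a mild solution whose norm stays bounded up to a time b < T can be continued past b (the continuation argument underlying the blow-up alternative, Proposition 5.3(b)). -/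

import Mathlib

open MeasureTheory Set

/-- Uniformly bounded operators that converge at `x` may be applied to a family tending to `x`. -/
theorem tendsto_clm_apply_of_norm_le {α 𝕜 E G : Type*} [NontriviallyNormedField 𝕜]
    [NormedAddCommGroup E] [NormedSpace 𝕜 E] [NormedAddCommGroup G] [NormedSpace 𝕜 G]
    {l : Filter α} {A : α → E →L[𝕜] G} {M : ℝ} {g : α → E} {x : E} {y : G}
    (hA : ∀ᶠ a in l, ‖A a‖ ≤ M) (hx : Filter.Tendsto (fun a => A a x) l (nhds y))
    (hg : Filter.Tendsto g l (nhds x)) :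
    Filter.Tendsto (fun a => A a (g a)) l (nhds y) := by
  have h0 : Filter.Tendsto (fun a => A a (g a - x)) l (nhds 0) := by
    have h1 : Filter.Tendsto (fun a => M * ‖g a - x‖) l (nhds 0) := by
      simpa using (tendsto_iff_norm_sub_tendsto_zero.1 hg).const_mul M
    refine squeeze_zero_norm' ?_ h1
    filter_upwards [hA] with a ha
    exact (A a).le_of_opNorm_le ha _
  simpa using h0.add hx

/-- Continuation of a bounded mild solution up to the endpoint (the continuation
argument underlying the blow-up alternative, Proposition 5.3(b)). -/
theorem mild_solution_continuation
    {𝒳 : Type*} [NormedAddCommGroup 𝒳] [NormedSpace ℂ 𝒳] [CompleteSpace 𝒳]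
    (T : ℝ) (hT : 0 < T)
    (U : ℝ → ℝ → 𝒳 →L[ℂ] 𝒳)
    (hU_id : ∀ s ∈ Icc (0:ℝ) T, U s s = ContinuousLinearMap.id ℂ 𝒳)
    (hU_comp : ∀ s r t : ℝ, 0 ≤ s → s ≤ r → r ≤ t → t ≤ T →
      (U t r).comp (U r s) = U t s)
    (hU_cont : ∀ x : 𝒳, ContinuousOn (fun p : ℝ × ℝ => U p.1 p.2 x)
      {p : ℝ × ℝ | 0 ≤ p.2 ∧ p.2 ≤ p.1 ∧ p.1 ≤ T})
    (M₀ : ℝ) (hM₀ : ∀ s t : ℝ, 0 ≤ s → s ≤ t → t ≤ T → ‖U t s‖ ≤ M₀)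
    (F : ℝ → 𝒳 → 𝒳)
    (hF : ContinuousOn (fun p : ℝ × 𝒳 => F p.1 p.2) (Icc (0:ℝ) T ×ˢ univ))
    (b : ℝ) (hb0 : 0 < b) (hbT : b ≤ T)
    (r K : ℝ) (hr : 0 ≤ r) (hK : 0 ≤ K)
    (hFbound : ∀ t ∈ Icc (0:ℝ) T, ∀ x : 𝒳, ‖x‖ ≤ r → ‖F t x‖ ≤ K)
    (X₀ : 𝒳)
    (X : ℝ → 𝒳)
    (hX : ContinuousOn X (Ico 0 b))
    (hXr : ∀ t ∈ Ico (0:ℝ) b, ‖X t‖ ≤ r)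
    (hXsol : ∀ t ∈ Ico (0:ℝ) b,
      X t = U t 0 X₀ + ∫ s in (0:ℝ)..t, U t s (F s (X s))) :
    ∃ ℓ : 𝒳,
      Filter.Tendsto X (nhdsWithin b (Iio b)) (nhds ℓ) ∧
      (ContinuousOn (fun t => if t < b then X t else ℓ) (Icc 0 b) ∧
        ∀ t ∈ Icc (0:ℝ) b,
          (if t < b then X t else ℓ) =
            U t 0 X₀ + ∫ s in (0:ℝ)..t,
              U t s (F s (if s < b then X s else ℓ))) := by
  set G : ℝ → 𝒳 := fun s => F s (X s) with hG
  have hGcont : ContinuousOn G (Ico 0 b) :=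
    hF.comp (f := fun s => (s, X s)) (continuousOn_id.prodMk hX)
      fun s hs => ⟨⟨hs.1, hs.2.le.trans hbT⟩, mem_univ _⟩
  have hGK : ∀ s ∈ Ico (0:ℝ) b, ‖G s‖ ≤ K := fun s hs =>
    hFbound s ⟨hs.1, hs.2.le.trans hbT⟩ _ (hXr s hs)
  have hM : 0 ≤ M₀ := (norm_nonneg _).trans (hM₀ 0 0 le_rfl le_rfl hT.le)
  have hleft : ∀ᶠ t in nhdsWithin b (Iio b), t ∈ Ioo 0 b := Ioo_mem_nhdsLT hb0
  have hUlim : ∀ s ∈ Ico (0:ℝ) b, ∀ x : 𝒳,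
      Filter.Tendsto (fun t => U t s x) (nhdsWithin b (Iio b)) (nhds (U b s x)) := by
    intro s hs x
    have h := hU_cont x (b, s) ⟨hs.1, hs.2.le, hbT⟩
    refine h.tendsto.comp (f := fun t : ℝ => (t, s)) (tendsto_nhdsWithin_iff.2 ⟨?_, ?_⟩)
    · exact ((continuous_id.prodMk continuous_const).tendsto b).mono_left nhdsWithin_le_nhds
    · filter_upwards [Ioo_mem_nhdsLT hs.2] with t ht
      exact ⟨hs.1, ht.1.le, ht.2.le.trans hbT⟩
  have hintegrand : ∀ t ∈ Ioo (0:ℝ) b, ContinuousOn (fun s => U t s (G s)) (Icc 0 t) := by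
    intro t ht s hs
    have hsub : Icc 0 t ⊆ Ico 0 b := fun u hu => ⟨hu.1, hu.2.trans_lt ht.2⟩
    refine tendsto_clm_apply_of_norm_le (A := fun s => U t s) (M := M₀) ?_ ?_
      (hGcont.mono hsub s hs)
    · filter_upwards [self_mem_nhdsWithin] with u hu
      exact hM₀ u t hu.1 hu.2 (ht.2.le.trans hbT)
    · exact ((hU_cont (G s)).comp (f := fun u : ℝ => (t, u)) (s := Icc 0 t) (by fun_prop)
        fun u hu => ⟨hu.1, hu.2, ht.2.le.trans hbT⟩) s hs
  have hint : Filter.Tendsto (fun t => ∫ s in (0:ℝ)..t, U t s (G s))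
      (nhdsWithin b (Iio b)) (nhds (∫ s in (0:ℝ)..b, U b s (G s))) := by
    have hdom : Filter.Tendsto
        (fun t => ∫ s in (0:ℝ)..b, indicator {s | s ≤ t} (fun s => U t s (G s)) s)
        (nhdsWithin b (Iio b)) (nhds (∫ s in (0:ℝ)..b, U b s (G s))) := by
      refine intervalIntegral.tendsto_integral_filter_of_dominated_convergence
        (fun _ => M₀ * K) ?_ ?_ intervalIntegrable_const ?_
      · filter_upwards [hleft] with t ht
        have hms : MeasurableSet {s : ℝ | s ≤ t} := measurableSet_Iic
        rw [aestronglyMeasurable_indicator_iff hms, Measure.restrict_restrict hms]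
        refine ((hintegrand t ht).aestronglyMeasurable measurableSet_Icc).mono_measure
          (Measure.restrict_mono ?_ le_rfl)
        rintro s ⟨hst, hs⟩
        rw [uIoc_of_le hb0.le] at hs
        exact ⟨hs.1.le, hst⟩
      · filter_upwards [hleft] with t ht
        refine Filter.Eventually.of_forall fun s hs => ?_
        rw [uIoc_of_le hb0.le] at hs
        by_cases hst : s ≤ t
        · rw [indicator_of_mem (show s ∈ {s | s ≤ t} from hst)]
          exact ((U t s).le_of_opNorm_le_of_le (hM₀ s t hs.1.le hst (ht.2.le.trans hbT))
            (hGK s ⟨hs.1.le, hst.trans_lt ht.2⟩))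
        · rw [indicator_of_notMem (show s ∉ {s | s ≤ t} from hst), norm_zero]
          positivity
      · filter_upwards [Measure.ae_ne volume b] with s hsb hs
        rw [uIoc_of_le hb0.le] at hs
        have hlt : s < b := lt_of_le_of_ne hs.2 hsb
        refine (hUlim s ⟨hs.1.le, hlt⟩ (G s)).congr' ?_
        filter_upwards [Ioo_mem_nhdsLT hlt] with t ht
        rw [indicator_of_mem (show s ∈ {s | s ≤ t} from ht.1.le)]
    refine hdom.congr' ?_
    filter_upwards [hleft] with t ht
    exact intervalIntegral.integral_indicator ⟨ht.1.le, ht.2.le⟩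
  have hlim : Filter.Tendsto X (nhdsWithin b (Iio b))
      (nhds (U b 0 X₀ + ∫ s in (0:ℝ)..b, U b s (G s))) := by
    refine ((hUlim 0 ⟨le_rfl, hb0⟩ X₀).add hint).congr' ?_
    filter_upwards [hleft] with t ht
    exact (hXsol t ⟨ht.1.le, ht.2⟩).symm
  refine ⟨_, hlim, ?_, ?_⟩
  · generalize U b 0 X₀ + ∫ s in (0:ℝ)..b, U b s (G s) = ℓ at hlim
    have hIco : ContinuousOn (fun t => if t < b then X t else ℓ) (Ico 0 b) :=
      hX.congr fun t ht => if_pos ht.2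
    intro t ht
    rcases ht.2.lt_or_eq with htb | rfl
    · refine (hIco t ⟨ht.1, htb⟩).mono_of_mem_nhdsWithin ?_
      filter_upwards [self_mem_nhdsWithin, mem_nhdsWithin_of_mem_nhds (Iio_mem_nhds htb)]
        with u hu hub using ⟨hu.1, hub⟩
    · rw [← Ico_insert_right hb0.le, continuousWithinAt_insert_self]
      have h : Filter.Tendsto X (nhdsWithin t (Ico 0 t)) (nhds ℓ) :=
        hlim.mono_left (nhdsWithin_mono _ fun _ hu => hu.2)
      simp only [ContinuousWithinAt, lt_irrefl, if_false]
      refine h.congr' ?_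
      filter_upwards [self_mem_nhdsWithin] with u hu
      exact (if_pos hu.2).symm
  · intro t ht
    have heq : ∀ x : 𝒳, ∫ s in (0:ℝ)..t, U t s (F s (if s < b then X s else x)) =
        ∫ s in (0:ℝ)..t, U t s (G s) := by
      intro x
      refine intervalIntegral.integral_congr_ae ?_
      filter_upwards [Measure.ae_ne volume b] with s hsb hs
      rw [uIoc_of_le ht.1] at hs
      rw [if_pos (lt_of_le_of_ne (hs.2.trans ht.2) hsb)]
    rw [heq]
    rcases ht.2.lt_or_eq with htb | rfl
    · rw [if_pos htb]
      exact hXsol t ⟨ht.1, htb⟩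
    · rw [if_neg (lt_irrefl _)]
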